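/- Let A ⊆ E = EuclideanSpace ℝ (Fin d) be star-convex with respect to the origin. Then for every nonempty compact set S ⊆ E, the set 𝔤_S(A) is star-convex with respect to the origin, and for every collection 𝕊 of nonempty compact subsets of E, the set 𝔤_𝕊(A) is star-convex with respect to the origin. -/

import Mathlib

open Set Pointwise

noncomputable section

/-- The Voronoi cell of `c` with respect to the set `S`. -/
def vorCell {d : ℕ} (S : Set (EuclideanSpace ℝ (Fin d))) (c : EuclideanSpace ℝ (Fin d)) :
    Set (EuclideanSpace ℝ (Fin d)) :=
  {x | ∀ c' ∈ S, ‖x - c‖ ≤ ‖x - c'‖}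

/-- `Q` is G-invariant with respect to `S`. -/
def GInvariant {d : ℕ} (S Q : Set (EuclideanSpace ℝ (Fin d))) : Prop :=
  ∀ x ∈ convexHull ℝ S, ∀ e ∈ Q, ∀ c ∈ S, e + x ∈ vorCell S c → e + x - c ∈ Q

/-- `Q` is G-invariant with respect to the collection `𝕊`. -/
def GInvariantColl {d : ℕ} (𝕊 : Set (Set (EuclideanSpace ℝ (Fin d))))
    (Q : Set (EuclideanSpace ℝ (Fin d))) : Prop :=
  ∀ S ∈ 𝕊, GInvariant S Q

/-- The set operator 𝔤_S. -/
def gOp {d : ℕ} (S A : Set (EuclideanSpace ℝ (Fin d))) : Set (EuclideanSpace ℝ (Fin d)) :=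
  ⋃ c ∈ S, (fun v => v - c) '' ((convexHull ℝ S + A) ∩ vorCell S c)

/-- The set operator 𝔤_𝕊. -/
def gOpColl {d : ℕ} (𝕊 : Set (Set (EuclideanSpace ℝ (Fin d))))
    (A : Set (EuclideanSpace ℝ (Fin d))) : Set (EuclideanSpace ℝ (Fin d)) :=
  ⋃ S ∈ 𝕊, gOp S A

/-- Iterates of 𝔤_𝕊. -/
def gIter {d : ℕ} (𝕊 : Set (Set (EuclideanSpace ℝ (Fin d))))
    (A : Set (EuclideanSpace ℝ (Fin d))) : ℕ → Set (EuclideanSpace ℝ (Fin d))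
  | 0 => A
  | n + 1 => gOpColl 𝕊 (gIter 𝕊 A n)

/-- Iterates of 𝔤_S for a single set S. -/
def gIterS {d : ℕ} (S A : Set (EuclideanSpace ℝ (Fin d))) :
    ℕ → Set (EuclideanSpace ℝ (Fin d))
  | 0 => A
  | n + 1 => gOp S (gIterS S A n)

/-- `D` is F-invariant with respect to `S`. -/
def FInvariant {d : ℕ} (S D : Set (EuclideanSpace ℝ (Fin d))) : Prop :=
  ∀ z ∈ D, ∀ c ∈ S, z ∈ vorCell S c → ∀ x ∈ convexHull ℝ S, z + x - c ∈ D

/-- `D` is F-invariant with respect to the collection `𝕊`. -/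
def FInvariantColl {d : ℕ} (𝕊 : Set (Set (EuclideanSpace ℝ (Fin d))))
    (D : Set (EuclideanSpace ℝ (Fin d))) : Prop :=
  ∀ S ∈ 𝕊, FInvariant S D

/-- The set operator 𝔭_S. -/
def pOp {d : ℕ} (S D : Set (EuclideanSpace ℝ (Fin d))) : Set (EuclideanSpace ℝ (Fin d)) :=
  convexHull ℝ S + ⋃ c ∈ S, (fun v => v - c) '' (D ∩ vorCell S c)

/-- The set operator 𝔭_𝕊. -/
def pOpColl {d : ℕ} (𝕊 : Set (Set (EuclideanSpace ℝ (Fin d))))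
    (D : Set (EuclideanSpace ℝ (Fin d))) : Set (EuclideanSpace ℝ (Fin d)) :=
  ⋃ S ∈ 𝕊, pOp S D

/-- Iterates of 𝔭_𝕊. -/
def pIter {d : ℕ} (𝕊 : Set (Set (EuclideanSpace ℝ (Fin d))))
    (D : Set (EuclideanSpace ℝ (Fin d))) : ℕ → Set (EuclideanSpace ℝ (Fin d))
  | 0 => D
  | n + 1 => pOpColl 𝕊 (pIter 𝕊 D n)

/-- The convexified set operator 𝔊_𝕊. -/
def GOpColl {d : ℕ} (𝕊 : Set (Set (EuclideanSpace ℝ (Fin d))))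
    (A : Set (EuclideanSpace ℝ (Fin d))) : Set (EuclideanSpace ℝ (Fin d)) :=
  ⋃ S ∈ 𝕊, convexHull ℝ (gOp S A)

/-- Iterates of the convexified operator 𝔊_𝕊. -/
def GIter {d : ℕ} (𝕊 : Set (Set (EuclideanSpace ℝ (Fin d))))
    (Q : Set (EuclideanSpace ℝ (Fin d))) : ℕ → Set (EuclideanSpace ℝ (Fin d))
  | 0 => convexHull ℝ Q
  | n + 1 => GOpColl 𝕊 (GIter 𝕊 Q n)


/-- A Voronoi cell is star-convex with respect to its center. -/
theorem starConvex_vorCell {d : ℕ} (S : Set (EuclideanSpace ℝ (Fin d)))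
    (c : EuclideanSpace ℝ (Fin d)) : StarConvex ℝ c (vorCell S c) := by
  intro x hx s t hs ht hst c' hc'
  obtain rfl : s = 1 - t := by linarith
  have hxc := hx c' hc'
  have htri := norm_add_le ((1 - t) • c + t • x - c') ((1 - t) • (x - c))
  rw [show (1 - t) • c + t • x - c' + (1 - t) • (x - c) = x - c' by module,
    norm_smul, Real.norm_of_nonneg hs] at htri
  rw [show (1 - t) • c + t • x - c = t • (x - c) by module, norm_smul, Real.norm_of_nonneg ht]
  linarith

/-- The operator `gOp S` preserves star-convexity with respect to the origin. -/
theorem StarConvex.gOp {d : ℕ} {A : Set (EuclideanSpace ℝ (Fin d))} (hA : StarConvex ℝ 0 A)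
    (S : Set (EuclideanSpace ℝ (Fin d))) : StarConvex ℝ 0 (gOp S A) := by
  refine starConvex_iUnion₂ fun c hc => ?_
  have hsum : StarConvex ℝ c (convexHull ℝ S + A) := by
    simpa using ((convex_convexHull ℝ S).starConvex (subset_convexHull ℝ S hc)).add hA
  simpa [sub_eq_add_neg, add_comm] using
    (hsum.inter (starConvex_vorCell S c)).add_left (-c)

theorem stmt8 {d : ℕ} (A : Set (EuclideanSpace ℝ (Fin d)))
    (hA : StarConvex ℝ 0 A) :
    (∀ S : Set (EuclideanSpace ℝ (Fin d)), S.Nonempty → IsCompact S →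
      StarConvex ℝ 0 (gOp S A)) ∧
    (∀ 𝕊 : Set (Set (EuclideanSpace ℝ (Fin d))), (∀ S ∈ 𝕊, S.Nonempty ∧ IsCompact S) →
      StarConvex ℝ 0 (gOpColl 𝕊 A)) := by
  refine ⟨fun S _ _ => hA.gOp S, fun 𝕊 _ => ?_⟩
  exact starConvex_iUnion₂ fun S _ => hA.gOp S
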